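/- Let q : (0,∞) → ℂ be measurable with ∫_0^∞ (1+x)|q(x)| dx < ∞. Then the zeros of the Jost function ψ in the open upper half-plane satisfy the Blaschke-type condition: there exists a constant C ≥ 0 such that for every finite set S of distinct points k ∈ ℂ₊ = {Im k > 0} with ψ(k) = 0, one has ∑_{k∈S} Im k ≤ C. -/

import Mathlib

open MeasureTheory Complex Filter Set

/-- The kernel `G(t,k) = (sin(kt)/k)·e^{ikt}` for `k ≠ 0`, with `G(t,0) = t`. -/
noncomputable def G (t : ℝ) (k : ℂ) : ℂ :=
  if k = 0 then (t : ℂ) else Complex.sin (k * t) / k * Complex.exp (Complex.I * k * t)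

/-- The previous node `t_{j-1}` of the simplex `x = t₀ < t₁ < ⋯ < t_n`. -/
noncomputable def prevNode (x : ℝ) {n : ℕ} (t : Fin n → ℝ) (j : Fin n) : ℝ :=
  if (j : ℕ) = 0 then x
  else t ⟨(j : ℕ) - 1, Nat.lt_of_le_of_lt (Nat.sub_le _ _) j.isLt⟩

/-- The iterated simplex integral
`y_n(x,k) = ∫_{x = t₀ < t₁ < ⋯ < t_n} ∏_{j=1}^n G(t_j − t_{j−1}, k)·q(t_j) dt₁⋯dt_n`. -/
noncomputable def ysimp (q : ℝ → ℂ) (n : ℕ) (x : ℝ) (k : ℂ) : ℂ :=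
  ∫ t : Fin n → ℝ in {t | StrictMono t ∧ ∀ i, x < t i},
    ∏ j, G (t j - prevNode x t j) k * q (t j)

/-- The Jost function `ψ(k) = 1 + ∑_{n ≥ 1} y_n(0,k)`. -/
noncomputable def jost (q : ℝ → ℂ) (k : ℂ) : ℂ :=
  1 + ∑' n : ℕ, ysimp q (n + 1) 0 k


def simplexSet (n : ℕ) : Set (Fin n → ℝ) := {t | StrictMono t ∧ ∀ i, (0:ℝ) < t i}

lemma measurableSet_simplexSet (n : ℕ) : MeasurableSet (simplexSet n) := by
  have : simplexSet n = (⋂ i, ⋂ j, {t : Fin n → ℝ | i < j → t i < t j}) ∩ ⋂ i, {t | 0 < t i} := by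
    ext t
    simp [simplexSet, StrictMono]
  rw [this]
  refine MeasurableSet.inter ?_ ?_
  · refine MeasurableSet.iInter fun i => MeasurableSet.iInter fun j => ?_
    by_cases h : i < j
    · simp only [h, true_imp_iff]
      exact measurableSet_lt (measurable_pi_apply i) (measurable_pi_apply j)
    · simp [h]
  · exact MeasurableSet.iInter fun i => measurableSet_lt measurable_const (measurable_pi_apply i)

lemma piCongrLeft_eq_comp {n : ℕ} (σ : Equiv.Perm (Fin n)) (t : Fin n → ℝ) :
    MeasurableEquiv.piCongrLeft (fun _ => ℝ) σ t = t ∘ σ.symm := by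
  funext i
  obtain ⟨j, rfl⟩ := σ.surjective i
  have := Equiv.piCongrLeft_apply_apply (fun _ : Fin n => ℝ) σ t j
  rw [MeasurableEquiv.coe_piCongrLeft]
  simpa only [Function.comp, Equiv.symm_apply_apply] using this

lemma simplex_disjoint {n : ℕ} {t : Fin n → ℝ} {σ τ : Equiv.Perm (Fin n)}
    (h1 : StrictMono (t ∘ σ.symm)) (h2 : StrictMono (t ∘ τ.symm)) : σ = τ := by
  have hr : Set.range (t ∘ σ.symm) = Set.range (t ∘ τ.symm) := by
    rw [σ.symm.surjective.range_comp, τ.symm.surjective.range_comp]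
  have heq := (StrictMono.range_inj h1 h2).1 hr
  have hinj : Function.Injective t := by
    have := h1.injective.comp σ.injective
    simpa [Function.comp_assoc] using this
  have : σ.symm = τ.symm := by
    ext i
    exact congrArg _ (hinj (congrFun heq i))
  simpa using congrArg Equiv.symm this

lemma simplex_integral (h : ℝ → ℝ) (h0 : ∀ x, 0 ≤ h x) (hint : IntegrableOn h (Ioi 0)) (n : ℕ) :
    IntegrableOn (fun t : Fin n → ℝ => ∏ j, h (t j)) (simplexSet n) ∧
    ∫ t in simplexSet n, ∏ j, h (t j) ≤ (∫ x in Ioi 0, h x) ^ n / n.factorial := by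
  set H : ℝ → ℝ := (Ioi (0:ℝ)).indicator h with hH
  have hHi : Integrable H := (integrable_indicator_iff measurableSet_Ioi).2 hint
  have hH0 : ∀ x, 0 ≤ H x := fun x => indicator_nonneg (fun _ _ => h0 _) x
  set P : (Fin n → ℝ) → ℝ := fun t => ∏ j, H (t j) with hP
  have hPi : Integrable P := Integrable.fintype_prod (f := fun _ => H) (fun _ => hHi)
  have hP0 : ∀ t, 0 ≤ P t := fun t => Finset.prod_nonneg fun j _ => hH0 _
  have hPe : EqOn P (fun t : Fin n → ℝ => ∏ j, h (t j)) (simplexSet n) := by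
    intro t ht
    refine Finset.prod_congr rfl fun j _ => ?_
    exact indicator_of_mem (ht.2 j) _
  refine ⟨(hPi.integrableOn).congr_fun hPe (measurableSet_simplexSet n), ?_⟩
  rw [← setIntegral_congr_fun (measurableSet_simplexSet n) hPe]
  have htot : ∫ t, P t = (∫ x in Ioi 0, h x) ^ n := by
    rw [hP, integral_fintype_prod_volume_eq_pow, hH, integral_indicator measurableSet_Ioi]
    simp
  rw [le_div_iff₀ (by positivity), ← htot]
  let D : Equiv.Perm (Fin n) → Set (Fin n → ℝ) := fun σ =>
    (MeasurableEquiv.piCongrLeft (fun _ => ℝ) σ) ⁻¹' simplexSet n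
  have hDm : ∀ σ, MeasurableSet (D σ) := fun σ =>
    (MeasurableEquiv.measurable _) (measurableSet_simplexSet n)
  have hDe : ∀ σ, ∫ t in D σ, P t = ∫ t in simplexSet n, P t := by
    intro σ
    rw [← (volume_measurePreserving_piCongrLeft (fun _ => ℝ) σ).setIntegral_preimage_emb
      (MeasurableEquiv.measurableEmbedding _) P (simplexSet n)]
    congr 1
    funext t
    rw [piCongrLeft_eq_comp]
    exact (Equiv.prod_comp σ.symm (fun j => H (t j))).symm
  have hdisj : Pairwise (Function.onFun Disjoint D) := by
    intro σ τ hst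
    refine Set.disjoint_left.2 fun t h1 h2 => hst ?_
    simp only [D, mem_preimage, piCongrLeft_eq_comp] at h1 h2
    exact simplex_disjoint h1.1 h2.1
  have hsum := integral_iUnion_fintype hDm hdisj (fun σ => hPi.integrableOn (s := D σ))
  simp only [hDe, Finset.sum_const, Finset.card_univ, Fintype.card_perm, Fintype.card_fin,
    nsmul_eq_mul] at hsum
  rw [mul_comm, ← hsum]
  exact setIntegral_le_integral hPi (Eventually.of_forall hP0)

lemma param_diff {α : Type*} [MeasurableSpace α] (μ : Measure α) (F : ℂ → α → ℂ) (bound : α → ℝ)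
    {U : Set ℂ} (hU : IsOpen U) (hm : ∀ z, AEStronglyMeasurable (F z) μ)
    (hd : ∀ᵐ a ∂μ, DifferentiableOn ℂ (fun z => F z a) U)
    (hb : ∀ᵐ a ∂μ, ∀ z ∈ U, ‖F z a‖ ≤ bound a) (hbi : Integrable bound μ) :
    DifferentiableOn ℂ (fun z => ∫ a, F z a ∂μ) U := by
  intro z hz
  obtain ⟨r, hr, hrU⟩ := Metric.isOpen_iff.1 hU z hz
  have hint : Integrable (F z) μ :=
    hbi.mono' (hm z) (hb.mono fun a ha => ha z hz)
  have hF'm : AEStronglyMeasurable (fun a => deriv (fun w => F w a) z) μ := by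
    obtain ⟨u, -, hu, hlim⟩ := exists_seq_strictAnti_tendsto (0:ℝ)
    have hlim' : Tendsto (fun n => ((u n : ℝ) : ℂ)) atTop (nhdsWithin 0 {0}ᶜ) := by
      refine tendsto_nhdsWithin_iff.2 ⟨?_, ?_⟩
      · exact_mod_cast (Complex.continuous_ofReal.tendsto 0).comp hlim
      · exact Eventually.of_forall fun n => by simpa using (hu n).ne'
    refine aestronglyMeasurable_of_tendsto_ae atTop
      (f := fun n a => ((u n : ℝ) : ℂ)⁻¹ • (F (z + u n) a - F z a))
      (fun n => ((hm (z + u n)).sub (hm z)).const_smul ((u n : ℝ) : ℂ)⁻¹) ?_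
    filter_upwards [hd] with a ha
    have := (ha.differentiableAt (hU.mem_nhds hz)).hasDerivAt
    exact this.tendsto_slope_zero.comp hlim'
  have key := hasDerivAt_integral_of_dominated_loc_of_deriv_le (μ := μ) (F := F) (x₀ := z)
    (s := Metric.ball z (r/2)) (bound := fun a => bound a / (r/2))
    (F' := fun w a => deriv (fun w => F w a) w)
    (Metric.ball_mem_nhds _ (by positivity)) (Eventually.of_forall hm) hint hF'm ?_
    (hbi.div_const _) ?_
  · exact key.2.differentiableAt.differentiableWithinAt
  · filter_upwards [hd, hb] with a ha hb w hw
    have hsub : Metric.closedBall w (r/2) ⊆ U := by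
      refine subset_trans ?_ hrU
      intro v hv
      rw [Metric.mem_ball] at *
      rw [Metric.mem_closedBall] at hv
      linarith [dist_triangle v w z]
    refine Complex.norm_deriv_le_of_forall_mem_sphere_norm_le (by positivity) ?_ ?_
    · apply DifferentiableOn.diffContOnCl
      exact ha.mono (Metric.closure_ball_subset_closedBall.trans hsub)
    · intro v hv
      exact hb v (hsub (Metric.sphere_subset_closedBall hv))
  · filter_upwards [hd] with a ha w hw
    refine (ha.differentiableAt (hU.mem_nhds (hrU ?_))).hasDerivAt
    exact Metric.ball_subset_ball (by linarith) hw

/-- One Schwarz step in the upper half-plane. -/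
lemma schwarz_step {f : ℂ → ℂ} {B : ℝ} (hf : DifferentiableOn ℂ f {z | 0 < z.im})
    (hB : ∀ z : ℂ, 0 < z.im → ‖f z‖ ≤ B) {a : ℂ} (ha : 0 < a.im) (hfa : f a = 0)
    {z : ℂ} (hz : 0 < z.im) : ‖f z‖ * ‖z - starRingEnd ℂ a‖ ≤ B * ‖z - a‖ := by
  let c : ℂ := starRingEnd ℂ a
  let φ : ℂ → ℂ := fun w => (a - c * w) / (1 - w)
  have hne : ∀ w ∈ Metric.ball (0:ℂ) 1, 1 - w ≠ 0 := by
    intro w hw h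
    have : w = 1 := by linear_combination -h
    simp [this] at hw
  have him : ∀ w ∈ Metric.ball (0:ℂ) 1, 0 < (φ w).im := by
    intro w hw
    have h1 := hne w hw
    have hn : 0 < normSq (1 - w) := normSq_pos.2 h1
    have hw' : normSq w < 1 := by
      rw [normSq_eq_norm_sq]
      have : ‖w‖ < 1 := by simpa using hw
      nlinarith [norm_nonneg w]
    have : (φ w).im = a.im * (1 - normSq w) / normSq (1 - w) := by
      simp only [φ, c, Complex.div_im, normSq_apply, sub_re, sub_im, mul_re, mul_im, conj_re, conj_im,
        one_re, one_im]
      ring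
    rw [this]
    have : 0 < 1 - normSq w := by linarith
    positivity
  have hzc : z - c ≠ 0 := by
    intro h
    have := congrArg Complex.im h
    simp [c] at this
    linarith
  have hca : c - a ≠ 0 := by
    intro h
    have := congrArg Complex.im h
    simp [c] at this
    linarith
  have hw : (z - a) / (z - c) ∈ Metric.ball (0:ℂ) 1 := by
    rw [mem_ball_zero_iff, norm_div, div_lt_one (norm_pos_iff.2 hzc)]
    apply lt_of_pow_lt_pow_left₀ 2 (norm_nonneg _)
    rw [← normSq_eq_norm_sq, ← normSq_eq_norm_sq]
    simp only [c, normSq_apply, sub_re, sub_im, conj_re, conj_im]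
    nlinarith [mul_pos ha hz]
  have hφz : φ ((z - a) / (z - c)) = z := by
    have h1 := hne _ hw
    simp only [φ]
    rw [div_eq_iff h1]
    field_simp
    ring
  have hφ0 : φ 0 = a := by simp [φ]
  have hd : DifferentiableOn ℂ (f ∘ φ) (Metric.ball 0 1) := by
    refine hf.comp (t := {z | 0 < z.im}) ?_ him
    refine DifferentiableOn.div (by fun_prop) (by fun_prop) hne
  have key := Complex.dist_le_div_mul_dist_of_mapsTo_ball (R₂ := B) hd ?_ hw
  · simp only [Function.comp, hφz, hφ0, hfa, dist_zero_right, norm_div, div_one] at key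
    rw [← mul_div_assoc, le_div_iff₀ (norm_pos_iff.2 hzc)] at key
    exact key
  · intro w hw
    simp only [Function.comp, hφ0, hfa, mem_closedBall_zero_iff]
    exact hB _ (him w hw)

lemma blaschke_prod (S : Finset ℂ) : ∀ {f : ℂ → ℂ} {B : ℝ}
    (_ : DifferentiableOn ℂ f {z | 0 < z.im})
    (_ : ∀ z : ℂ, 0 < z.im → ‖f z‖ ≤ B) (_ : ∀ a ∈ S, 0 < a.im ∧ f a = 0)
    {z : ℂ} (_ : 0 < z.im), ‖f z‖ ≤ B * ∏ a ∈ S, (‖z - a‖ / ‖z - starRingEnd ℂ a‖) := by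
  classical
  induction S using Finset.induction_on with
  | empty => intro f B hf hB _ z hz; simpa using hB z hz
  | insert a S haS ih =>
    intro f B hf hB hS z hz
    have ha := hS a (Finset.mem_insert_self _ _)
    have hopen : IsOpen {z : ℂ | 0 < z.im} := isOpen_lt continuous_const Complex.continuous_im
    have hnhds : {z : ℂ | 0 < z.im} ∈ nhds a := hopen.mem_nhds ha.1
    let g : ℂ → ℂ := fun z => dslope f a z * (z - starRingEnd ℂ a)
    have hg : DifferentiableOn ℂ g {z | 0 < z.im} :=
      ((Complex.differentiableOn_dslope hnhds).2 hf).mul (by fun_prop)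
    have hfg : ∀ w, f w * (w - starRingEnd ℂ a) = (w - a) * g w := by
      intro w
      have := sub_smul_dslope f a w
      simp only [ha.2, sub_zero, smul_eq_mul] at this
      simp only [g]
      rw [← this]; ring
    have hg1 : ∀ w : ℂ, 0 < w.im → w ≠ a → ‖g w‖ ≤ B := by
      intro w hw hwa
      have h1 := schwarz_step hf hB ha.1 ha.2 hw
      rw [← norm_mul, hfg, norm_mul, mul_comm] at h1
      exact le_of_mul_le_mul_right h1 (norm_pos_iff.2 (sub_ne_zero.2 hwa))
    have hgB : ∀ w : ℂ, 0 < w.im → ‖g w‖ ≤ B := by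
      intro w hw
      by_cases hwa : w = a
      · subst hwa
        have hc : Tendsto (fun v => ‖g v‖) (nhdsWithin w {w}ᶜ) (nhds ‖g w‖) :=
          ((hg.differentiableAt hnhds).continuousAt.norm.tendsto).mono_left nhdsWithin_le_nhds
        refine le_of_tendsto hc ?_
        filter_upwards [self_mem_nhdsWithin, mem_nhdsWithin_of_mem_nhds hnhds] with v hv hv'
        exact hg1 v hv' hv
      · exact hg1 w hw hwa
    have hgS : ∀ b ∈ S, 0 < b.im ∧ g b = 0 := by
      intro b hb
      have hbS := hS b (Finset.mem_insert_of_mem hb)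
      refine ⟨hbS.1, ?_⟩
      have := hfg b
      rw [hbS.2, zero_mul, eq_comm, mul_eq_zero] at this
      refine this.resolve_left (sub_ne_zero.2 ?_)
      rintro rfl; exact haS hb
    have := ih hg hgB hgS hz
    rw [Finset.prod_insert haS]
    have hzc : z - starRingEnd ℂ a ≠ 0 := by
      intro h
      have := congrArg Complex.im h
      simp at this
      linarith
    have hfz : ‖f z‖ = ‖z - a‖ / ‖z - starRingEnd ℂ a‖ * ‖g z‖ := by
      rw [div_mul_eq_mul_div, eq_div_iff (norm_ne_zero_iff.2 hzc), ← norm_mul, hfg, norm_mul]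
    rw [hfz]
    calc _ ≤ ‖z - a‖ / ‖z - starRingEnd ℂ a‖ * _ := mul_le_mul_of_nonneg_left this (by positivity)
      _ = _ := by ring

lemma G_eq (t : ℝ) {k : ℂ} (hk : k ≠ 0) :
    G t k = (Complex.exp (2 * I * k * t) - 1) / (2 * I * k) := by
  have hI : I ≠ 0 := I_ne_zero
  have h1 : Complex.exp (2 * I * k * t) = Complex.exp (I * k * t) * Complex.exp (I * k * t) := by
    rw [← Complex.exp_add]; ring_nf
  have h2 : Complex.exp (-(k * t) * I) * Complex.exp (I * k * t) = 1 := by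
    rw [← Complex.exp_add, ← Complex.exp_zero]; ring_nf
  have h3 : Complex.exp (k * t * I) = Complex.exp (I * k * t) := by ring_nf
  rw [G, if_neg hk, Complex.sin, h1, h3, eq_div_iff (by simp [hk])]
  generalize Complex.exp (I * k * t) = E at h2 ⊢
  generalize Complex.exp (-(k * t) * I) = N at h2 ⊢
  have h4 : (N - E) * I / 2 / k * E * (2 * I * k) = (N - E) * I * E * I := by
    field_simp
  rw [h4]
  linear_combination I ^ 2 * h2 + (1 - E ^ 2) * I_sq

lemma norm_G_le (t : ℝ) (ht : 0 ≤ t) {k : ℂ} (hk : 0 < k.im) : ‖G t k‖ ≤ t := by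
  have hk0 : k ≠ 0 := by rintro rfl; simp at hk
  have hk' : 0 < ‖k‖ := norm_pos_iff.2 hk0
  rw [G_eq t hk0, norm_div, div_le_iff₀ (by simpa using hk0)]
  have := Convex.norm_image_sub_le_of_norm_deriv_le (𝕜 := ℂ) (f := Complex.exp) (C := 1)
    (s := {z : ℂ | z.re ≤ 0}) (x := 0) (y := 2 * I * k * t)
    (fun x _ => Complex.differentiable_exp x) ?_ (convex_halfSpace_re_le 0) (by simp) ?_
  · simp only [Complex.exp_zero, sub_zero, one_mul, norm_mul, norm_real, Real.norm_of_nonneg ht] at this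
    simpa [mul_comm, mul_left_comm, mul_assoc] using this
  · intro x hx
    simp only [Complex.deriv_exp, Complex.norm_exp]
    simpa using hx
  · simp; positivity

lemma norm_G_le' (t : ℝ) (ht : 0 ≤ t) {k : ℂ} (hk : 0 < k.im) : ‖G t k‖ ≤ 1 / ‖k‖ := by
  have hk0 : k ≠ 0 := by rintro rfl; simp at hk
  have hk' : 0 < ‖k‖ := norm_pos_iff.2 hk0
  rw [G_eq t hk0, norm_div, div_le_div_iff₀ (by simpa using hk0) hk']
  have h1 : ‖Complex.exp (2 * I * k * t)‖ ≤ 1 := by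
    rw [Complex.norm_exp, Real.exp_le_one_iff]
    simp; positivity
  have h2 : ‖Complex.exp (2 * I * k * t) - 1‖ ≤ 2 := by
    refine (norm_sub_le _ _).trans ?_
    simp; linarith
  simp
  nlinarith

lemma differentiableOn_G (t : ℝ) : DifferentiableOn ℂ (fun k => G t k) {z | 0 < z.im} := by
  have hne : ∀ k ∈ {z : ℂ | 0 < z.im}, k ≠ 0 := by
    rintro k hk rfl; simp at hk
  refine DifferentiableOn.congr (f := fun k : ℂ => (Complex.exp (2 * I * k * t) - 1) / (2 * I * k)) ?_
    (fun k hk => G_eq t (hne k hk))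
  refine DifferentiableOn.div (by fun_prop) (by fun_prop) ?_
  intro k hk
  simpa using hne k hk

lemma measurable_G (k : ℂ) : Measurable (fun t => G t k) := by
  unfold G
  split_ifs
  · fun_prop
  · fun_prop

lemma prevNode_bounds {n : ℕ} {t : Fin n → ℝ} (ht : t ∈ simplexSet n) (j : Fin n) :
    0 ≤ t j - prevNode 0 t j ∧ t j - prevNode 0 t j ≤ t j := by
  unfold prevNode
  split_ifs with h
  · have := ht.2 j
    constructor <;> linarith
  · have h1 : (⟨(j : ℕ) - 1, Nat.lt_of_le_of_lt (Nat.sub_le _ _) j.isLt⟩ : Fin n) < j := by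
      rw [Fin.lt_def]; simp only; omega
    have := ht.1 h1
    have := ht.2 ⟨(j : ℕ) - 1, Nat.lt_of_le_of_lt (Nat.sub_le _ _) j.isLt⟩
    constructor <;> linarith

lemma measurable_integrand {q : ℝ → ℂ} (hmq : Measurable q) (n : ℕ) (k : ℂ) :
    Measurable (fun t : Fin n → ℝ => ∏ j, G (t j - prevNode 0 t j) k * q (t j)) := by
  refine Finset.measurable_prod _ fun j _ => ?_
  refine Measurable.mul ((measurable_G k).comp ?_) (hmq.comp (measurable_pi_apply j))
  refine (measurable_pi_apply j).sub ?_
  unfold prevNode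
  split_ifs
  · exact measurable_const
  · exact measurable_pi_apply _

lemma ysimp_norm_le {q : ℝ → ℂ} (h : ℝ → ℝ) (h0 : ∀ x, 0 ≤ h x) (hint : IntegrableOn h (Ioi 0))
    (n : ℕ) (k : ℂ)
    (hb : ∀ t ∈ simplexSet n, ∀ j, ‖G (t j - prevNode 0 t j) k * q (t j)‖ ≤ h (t j)) :
    ‖ysimp q n 0 k‖ ≤ (∫ x in Ioi 0, h x) ^ n / n.factorial := by
  obtain ⟨h1, h2⟩ := simplex_integral h h0 hint n
  refine le_trans ?_ h2
  refine norm_integral_le_of_norm_le h1 ?_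
  refine (ae_restrict_iff' (measurableSet_simplexSet n)).2 (Eventually.of_forall fun t ht => ?_)
  rw [norm_prod]
  exact Finset.prod_le_prod (fun _ _ => norm_nonneg _) fun j _ => hb t ht j

lemma integrand_le {q : ℝ → ℂ} {n : ℕ} {k : ℂ} (hk : 0 < k.im) {t : Fin n → ℝ}
    (ht : t ∈ simplexSet n) (j : Fin n) :
    ‖G (t j - prevNode 0 t j) k * q (t j)‖ ≤ |t j| * ‖q (t j)‖ := by
  have := prevNode_bounds ht j
  rw [norm_mul]
  gcongr
  exact ((norm_G_le _ this.1 hk).trans this.2).trans (le_abs_self _)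

lemma integrand_le' {q : ℝ → ℂ} {n : ℕ} {k : ℂ} (hk : 0 < k.im) {t : Fin n → ℝ}
    (ht : t ∈ simplexSet n) (j : Fin n) :
    ‖G (t j - prevNode 0 t j) k * q (t j)‖ ≤ 1 / ‖k‖ * ‖q (t j)‖ := by
  have := prevNode_bounds ht j
  rw [norm_mul]
  gcongr
  exact norm_G_le' _ this.1 hk

lemma ysimp_differentiableOn {q : ℝ → ℂ} (hmq : Measurable q)
    (hint : IntegrableOn (fun x => |x| * ‖q x‖) (Ioi 0)) (n : ℕ) :
    DifferentiableOn ℂ (fun k => ysimp q n 0 k) {z | 0 < z.im} := by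
  obtain ⟨h1, -⟩ := simplex_integral _ (fun x => by positivity) hint n
  refine param_diff (volume.restrict (simplexSet n)) _ _
    (isOpen_lt continuous_const Complex.continuous_im)
    (fun z => (measurable_integrand hmq n z).aestronglyMeasurable) ?_ ?_ h1
  · refine Eventually.of_forall fun t => ?_
    refine DifferentiableOn.fun_finsetProd fun j _ => ?_
    exact (differentiableOn_G _).mul_const _
  · refine (ae_restrict_iff' (measurableSet_simplexSet n)).2 (Eventually.of_forall fun t ht k hk => ?_)
    rw [norm_prod]
    exact Finset.prod_le_prod (fun _ _ => norm_nonneg _) fun j _ => integrand_le hk ht j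

/-- If `q` is measurable with `∫_0^∞ (1+x)|q(x)| dx < ∞`, then the zeros of the Jost
function in the open upper half-plane satisfy the Blaschke condition: there is `C ≥ 0` such
that every finite set of distinct zeros satisfies `∑ Im k ≤ C`. -/
theorem jost_blaschke_condition (q : ℝ → ℂ) (hmq : Measurable q)
    (hq : IntegrableOn (fun x => (1 + x) * ‖q x‖) (Set.Ioi 0)) :
    ∃ C : ℝ, 0 ≤ C ∧ ∀ S : Finset ℂ,
      (∀ k ∈ S, 0 < k.im ∧ jost q k = 0) → ∑ k ∈ S, k.im ≤ C := by

  have hq1 : IntegrableOn (fun x => |x| * ‖q x‖) (Ioi 0) := by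
    refine Integrable.mono' hq (by fun_prop) ?_
    refine (ae_restrict_iff' measurableSet_Ioi).2 (Eventually.of_forall fun x hx => ?_)
    have hx : 0 < x := hx
    rw [Real.norm_of_nonneg (by positivity), abs_of_pos hx]
    nlinarith [norm_nonneg (q x)]
  have hq2 : IntegrableOn (fun x => ‖q x‖) (Ioi 0) := by
    refine Integrable.mono' hq (by fun_prop) ?_
    refine (ae_restrict_iff' measurableSet_Ioi).2 (Eventually.of_forall fun x hx => ?_)
    have hx : 0 < x := hx
    rw [norm_norm]
    nlinarith [norm_nonneg (q x)]
  set M := ∫ x in Ioi (0:ℝ), |x| * ‖q x‖ with hM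
  set A := ∫ x in Ioi (0:ℝ), ‖q x‖ with hA
  have hA0 : 0 ≤ A := integral_nonneg fun x => norm_nonneg _
  have hM0 : 0 ≤ M := integral_nonneg fun x => by positivity
  have hy1 : ∀ n k, 0 < k.im → ‖ysimp q (n+1) 0 k‖ ≤ M ^ (n+1) / (n+1).factorial := fun n k hk =>
    ysimp_norm_le _ (fun x => by positivity) hq1 (n+1) k (fun t ht j => integrand_le hk ht j)
  have hy2 : ∀ n k, 0 < k.im → ‖ysimp q (n+1) 0 k‖ ≤ (A / ‖k‖) ^ (n+1) := by
    intro n k hk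
    have := ysimp_norm_le (fun x => 1 / ‖k‖ * ‖q x‖) (fun x => by positivity) (hq2.const_mul _) (n+1) k
      (fun t ht j => integrand_le' hk ht j)
    rw [integral_const_mul, ← hA, one_div_mul_eq_div] at this
    refine this.trans (div_le_self (by positivity) ?_)
    exact_mod_cast Nat.factorial_pos _
  have hsM : Summable (fun n : ℕ => M ^ (n+1) / (n+1).factorial) :=
    (summable_nat_add_iff 1).2 (Real.summable_pow_div_factorial M)
  have hd : DifferentiableOn ℂ (jost q) {z | 0 < z.im} := by
    refine DifferentiableOn.const_add 1 ?_
    exact Complex.differentiableOn_tsum_of_summable_norm hsM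
      (fun n => ysimp_differentiableOn hmq hq1 (n+1))
      (isOpen_lt continuous_const Complex.continuous_im) (fun n k hk => hy1 n k hk)
  set B : ℝ := 1 + ∑' n : ℕ, M ^ (n+1) / (n+1).factorial with hBdef
  have hB1 : 1 ≤ B := by
    have : 0 ≤ ∑' n : ℕ, M ^ (n+1) / (n+1).factorial := tsum_nonneg fun n => by positivity
    linarith
  have hB : ∀ z : ℂ, 0 < z.im → ‖jost q z‖ ≤ B := by
    intro z hz
    refine (norm_add_le _ _).trans ?_
    rw [norm_one, hBdef]
    refine add_le_add le_rfl ?_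
    exact tsum_of_norm_bounded hsM.hasSum fun n => hy1 n z hz
  set R : ℝ := 4 * A + 1 with hR
  have hR0 : 0 < R := by positivity
  have hlow : ∀ z : ℂ, 0 < z.im → R ≤ ‖z‖ → 1 / 2 ≤ ‖jost q z‖ := by
    intro z hz hzR
    have hz0 : 0 < ‖z‖ := hR0.trans_le hzR
    have hr : A / ‖z‖ ≤ 1 / 4 := by
      rw [div_le_iff₀ hz0]; linarith
    have hs : HasSum (fun n : ℕ => (1 / 4 : ℝ) ^ (n+1)) (1 / 3) := by
      have := (hasSum_geometric_of_lt_one (r := (1/4 : ℝ)) (by norm_num) (by norm_num)).mul_left (1/4)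
      have e1 : (fun n : ℕ => (1 / 4 : ℝ) ^ (n+1)) = fun i => 1 / 4 * (1 / 4) ^ i := by
        funext n; ring
      have e2 : (1 / 3 : ℝ) = 1 / 4 * (1 - 1 / 4)⁻¹ := by norm_num
      rw [e1, e2]
      exact this
    have h1 : ‖∑' n : ℕ, ysimp q (n+1) 0 z‖ ≤ 1 / 3 :=
      tsum_of_norm_bounded hs fun n => (hy2 n z hz).trans
        (pow_le_pow_left₀ (by positivity) hr _)
    have h2 := norm_sub_le (jost q z) (∑' n : ℕ, ysimp q (n+1) 0 z)
    have h3 : jost q z - (∑' n : ℕ, ysimp q (n+1) 0 z) = 1 := by simp [jost]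
    rw [h3, norm_one] at h2
    linarith
  refine ⟨2 * R * Real.log (2 * B), ?_, ?_⟩
  · have : 0 ≤ Real.log (2 * B) := Real.log_nonneg (by linarith)
    positivity
  intro S hS
  have hzR : 0 < ((R : ℂ) * I).im := by simpa using hR0
  have h1 := blaschke_prod S hd hB hS hzR
  have h2 := hlow _ hzR (by simp [abs_of_pos hR0])
  have hfac : ∀ a ∈ S, ‖(R : ℂ) * I - a‖ / ‖(R : ℂ) * I - starRingEnd ℂ a‖
      ≤ Real.exp (-(a.im / (2 * R))) := by
    intro a ha
    obtain ⟨ha1, ha2⟩ := hS a ha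
    have haR : ‖a‖ < R := by
      by_contra hcon
      have := hlow a ha1 (not_lt.1 hcon)
      rw [ha2, norm_zero] at this
      norm_num at this
    have hden : 0 < normSq ((R : ℂ) * I - starRingEnd ℂ a) := by
      rw [normSq_pos]
      intro h
      have := congrArg Complex.im h
      simp at this
      linarith
    have hden2 : normSq ((R : ℂ) * I - starRingEnd ℂ a) ≤ 4 * R ^ 2 := by
      rw [normSq_eq_norm_sq]
      have : ‖(R : ℂ) * I - starRingEnd ℂ a‖ ≤ 2 * R := by
        refine (norm_sub_le _ _).trans ?_
        simp [abs_of_pos hR0]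
        linarith
      nlinarith [norm_nonneg ((R : ℂ) * I - starRingEnd ℂ a)]
    apply le_of_sq_le_sq _ (Real.exp_pos _).le
    rw [div_pow, ← normSq_eq_norm_sq, ← normSq_eq_norm_sq, ← Real.exp_nat_mul]
    have hnum : normSq ((R : ℂ) * I - a)
        = normSq ((R : ℂ) * I - starRingEnd ℂ a) - 4 * R * a.im := by
      simp [normSq_apply]; ring
    have hexp := Real.add_one_le_exp (((2:ℕ):ℝ) * -(a.im / (2 * R)))
    refine le_trans ?_ hexp
    rw [hnum, sub_div, div_self hden.ne']
    have : a.im / R ≤ 4 * R * a.im / normSq ((R : ℂ) * I - starRingEnd ℂ a) := by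
      rw [div_le_div_iff₀ hR0 hden]
      nlinarith
    have e : ((2:ℕ):ℝ) * -(a.im / (2 * R)) = - (a.im / R) := by
      push_cast; field_simp
    rw [e]
    linarith
  have h3 : ∏ a ∈ S, (‖(R : ℂ) * I - a‖ / ‖(R : ℂ) * I - starRingEnd ℂ a‖)
      ≤ Real.exp (-((∑ k ∈ S, k.im) / (2 * R))) := by
    refine (Finset.prod_le_prod (fun _ _ => by positivity) hfac).trans ?_
    rw [← Real.exp_sum, Finset.sum_neg_distrib, Finset.sum_div]
  have h4 : 1 / 2 ≤ B * Real.exp (-((∑ k ∈ S, k.im) / (2 * R))) :=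
    h2.trans (h1.trans (mul_le_mul_of_nonneg_left h3 (by linarith)))
  rw [Real.exp_neg, ← div_eq_mul_inv, le_div_iff₀ (Real.exp_pos _)] at h4
  have h5 : (∑ k ∈ S, k.im) / (2 * R) ≤ Real.log (2 * B) := by
    rw [Real.le_log_iff_exp_le (by linarith)]
    linarith
  rw [div_le_iff₀ (by positivity)] at h5
  linarith
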